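/- arXiv:2008.07567 — 5 statements merged into one kernel-verified Lean document; each statement's English description precedes it below -/
import Mathlib

section
/- For every integer N ≥ 1, the map sending an admissible N-tuple λ to the set {f_1, …, f_{N−1}} of its partial sums f_i = ∑_{k=1}^{i} (λ_k + 1) is a bijection from the set of admissible N-tuples onto the collection of (N−1)-element subsets S of {1, …, 2N−1} with N ∉ S and no two elements of S differing by exactly N. -/
/-- An admissible `N`-tuple: `λ : Fin N → ℕ` with `∑ (λᵢ + 1) = 2N` and every consecutive
sum `∑_{k=i}^{j} (λₖ + 1) ≠ N` for `i ≤ j`. -/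
def Admissible (N : ℕ) (lam : Fin N → ℕ) : Prop :=
  (∑ i, (lam i + 1)) = 2 * N ∧
  ∀ i j : Fin N, i ≤ j → (∑ k ∈ Finset.Icc i j, (lam k + 1)) ≠ N

/-- The partial sum `f_i = ∑_{k=1}^{i} (λₖ + 1)` (summing over indices `1 ≤ k ≤ i`). -/
def partialSum (N : ℕ) (lam : Fin N → ℕ) (i : ℕ) : ℕ :=
  ∑ k ∈ Finset.univ.filter (fun k : Fin N => 1 ≤ (k : ℕ) ∧ (k : ℕ) ≤ i), (lam k + 1)

theorem partialSum_zero (N : ℕ) (lam : Fin N → ℕ) : partialSum N lam 0 = 0 := by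
  unfold partialSum
  apply Finset.sum_eq_zero
  intro k hk
  simp only [Finset.mem_filter] at hk
  omega

theorem partialSum_succ {N : ℕ} (lam : Fin N → ℕ) {i : ℕ} (hi : i + 1 < N) :
    partialSum N lam (i + 1) = partialSum N lam i + (lam ⟨i + 1, hi⟩ + 1) := by
  have h : Finset.univ.filter (fun k : Fin N => 1 ≤ (k : ℕ) ∧ (k : ℕ) ≤ i + 1) =
      insert ⟨i + 1, hi⟩ (Finset.univ.filter (fun k : Fin N => 1 ≤ (k : ℕ) ∧ (k : ℕ) ≤ i)) := by
    ext k
    simp only [Finset.mem_filter, Finset.mem_univ, true_and, Finset.mem_insert, Fin.ext_iff]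
    omega
  unfold partialSum
  rw [h, Finset.sum_insert (by simp), add_comm]

theorem partialSum_lt {N : ℕ} (lam : Fin N → ℕ) {i j : ℕ} (hij : i < j) (hj : j < N) :
    partialSum N lam i < partialSum N lam j := by
  induction j, hij using Nat.le_induction with
  | base => rw [partialSum_succ lam hj]; omega
  | succ j _ ih =>
    have := ih (by omega)
    rw [partialSum_succ lam hj]
    omega

theorem partialSum_add_sum_Icc {N : ℕ} (lam : Fin N → ℕ) {i j : Fin N} (hi : 1 ≤ (i : ℕ))
    (hij : i ≤ j) :
    partialSum N lam (i - 1) + ∑ k ∈ Finset.Icc i j, (lam k + 1) = partialSum N lam j := by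
  unfold partialSum
  rw [← Finset.sum_union]
  · congr 1
    ext k
    simp only [Finset.mem_filter, Finset.mem_univ, true_and, Finset.mem_union, Finset.mem_Icc,
      Fin.le_def] at hij ⊢
    omega
  · rw [Finset.disjoint_left]
    intro k
    simp only [Finset.mem_filter, Finset.mem_univ, true_and, Finset.mem_Icc, Fin.le_def]
    omega

theorem sum_Icc_zero {N : ℕ} (hN : 0 < N) (lam : Fin N → ℕ) (j : Fin N) :
    ∑ k ∈ Finset.Icc ⟨0, hN⟩ j, (lam k + 1) = lam ⟨0, hN⟩ + 1 + partialSum N lam j := by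
  have h : Finset.Icc ⟨0, hN⟩ j = insert ⟨0, hN⟩
      (Finset.univ.filter (fun k : Fin N => 1 ≤ (k : ℕ) ∧ (k : ℕ) ≤ j)) := by
    ext k
    simp only [Finset.mem_filter, Finset.mem_univ, true_and, Finset.mem_insert, Fin.ext_iff,
      Finset.mem_Icc, Fin.le_def]
    omega
  unfold partialSum
  rw [h, Finset.sum_insert (by simp)]

theorem sum_eq_add_partialSum {N : ℕ} (hN : 0 < N) (lam : Fin N → ℕ) :
    ∑ k, (lam k + 1) = lam ⟨0, hN⟩ + 1 + partialSum N lam (N - 1) := by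
  rw [← sum_Icc_zero hN lam ⟨N - 1, by omega⟩]
  congr 1
  ext k
  simp only [Finset.mem_univ, Finset.mem_Icc, Fin.le_def, true_iff]
  omega

/-- Admissibility in terms of partial sums: no two of `f_0 = 0, f_1, …, f_{N-1}` differ
by `N`. -/
theorem admissible_iff {N : ℕ} (hN : 0 < N) (lam : Fin N → ℕ) :
    Admissible N lam ↔ lam ⟨0, hN⟩ + 1 + partialSum N lam (N - 1) = 2 * N ∧
      ∀ i j, i < j → j < N → partialSum N lam j ≠ partialSum N lam i + N := by
  unfold Admissible
  rw [sum_eq_add_partialSum hN]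
  refine and_congr_right fun hsum => ⟨fun h i j hij hj => ?_, fun h i j hij => ?_⟩
  · have h₁ := partialSum_add_sum_Icc lam (i := ⟨i + 1, by omega⟩) (j := ⟨j, hj⟩) (by simp)
      (by simp only [Fin.le_def]; omega)
    have h₂ := h ⟨i + 1, by omega⟩ ⟨j, hj⟩ (by simp only [Fin.le_def]; omega)
    simp only [Nat.add_sub_cancel] at h₁
    omega
  · rcases Nat.eq_zero_or_pos (i : ℕ) with hi | hi
    · obtain rfl : i = ⟨0, hN⟩ := Fin.ext hi
      rw [sum_Icc_zero hN]
      rcases lt_or_ge (j : ℕ) (N - 1) with hj | hj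
      · have := h j (N - 1) hj (by omega)
        omega
      · rw [show (j : ℕ) = N - 1 by omega]
        omega
    · have h₁ := partialSum_add_sum_Icc lam hi hij
      have h₂ := h (i - 1) j (by rw [Fin.le_def] at hij; omega) j.2
      omega

theorem eq_of_partialSum_eq {N : ℕ} (hN : 0 < N) {lam mu : Fin N → ℕ}
    (hlam : Admissible N lam) (hmu : Admissible N mu)
    (h : ∀ i < N, partialSum N lam i = partialSum N mu i) : lam = mu := by
  have h₁ := ((admissible_iff hN lam).1 hlam).1
  have h₂ := ((admissible_iff hN mu).1 hmu).1
  have h₃ := h (N - 1) (by omega)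
  funext ⟨i, hi⟩
  cases i with
  | zero => omega
  | succ i =>
    have h₄ := partialSum_succ lam hi
    have h₅ := partialSum_succ mu hi
    have h₆ := h i (by omega)
    have h₇ := h (i + 1) hi
    omega

theorem card_image_partialSum {N : ℕ} (lam : Fin N → ℕ) :
    ((Finset.Icc 1 (N - 1)).image (partialSum N lam)).card = N - 1 := by
  rw [Finset.card_image_of_injOn, Nat.card_Icc, Nat.add_sub_cancel]
  intro i hi j hj hij
  simp only [Finset.coe_Icc, Set.mem_Icc] at hi hj
  rcases lt_trichotomy i j with h | h | h
  · exact absurd hij (partialSum_lt lam h (by omega)).ne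
  · exact h
  · exact absurd hij.symm (partialSum_lt lam h (by omega)).ne

/-- The `i`-th partial sum is the `i`-th smallest element of any set of size `N - 1`
containing `f_1, …, f_{N-1}`. -/
theorem partialSum_eq_orderEmbOfFin {N : ℕ} (lam : Fin N → ℕ) {S : Finset ℕ}
    (hS : S.card = N - 1) (h : ∀ i ∈ Finset.Icc 1 (N - 1), partialSum N lam i ∈ S)
    (i : Fin (N - 1)) : partialSum N lam (i + 1) = S.orderEmbOfFin hS i := by
  have := Finset.orderEmbOfFin_unique hS (f := fun i : Fin (N - 1) => partialSum N lam (i + 1))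
    (fun i => h _ (by rw [Finset.mem_Icc]; omega))
    (fun i j hij => partialSum_lt lam (by rw [Fin.lt_def] at hij; omega) (by omega))
  exact congrFun this i

/-- A function vanishing at `0` and strictly increasing on `{0, …, N-1}` is a sequence of
partial sums, with prescribed zeroth entry. -/
theorem exists_partialSum_eq {N : ℕ} (hN : 0 < N) (F : ℕ → ℕ) (c : ℕ) (h0 : F 0 = 0)
    (hF : ∀ i, i + 1 < N → F i < F (i + 1)) :
    ∃ lam : Fin N → ℕ, lam ⟨0, hN⟩ = c ∧ ∀ i < N, partialSum N lam i = F i := by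
  refine ⟨fun k => if (k : ℕ) = 0 then c else F k - F (k - 1) - 1, by simp, fun i hi => ?_⟩
  induction i with
  | zero => rw [partialSum_zero, h0]
  | succ i ih =>
    rw [partialSum_succ _ hi, ih (by omega)]
    have := hF i hi
    simp only [Nat.add_sub_cancel, Nat.add_eq_zero_iff, one_ne_zero, and_false, if_false]
    omega

/-- the map `λ ↦ {f_1, …, f_{N-1}}` of partial sums is a bijection from the
set of admissible `N`-tuples onto the collection of `(N-1)`-element subsets `S` of
`{1, …, 2N-1}` with `N ∉ S` and no two elements of `S` differing by exactly `N`. -/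
theorem partialSums_bijOn (N : ℕ) (hN : 1 ≤ N) :
    Set.BijOn (fun lam : Fin N → ℕ => (Finset.Icc 1 (N - 1)).image (partialSum N lam))
      {lam | Admissible N lam}
      {S : Finset ℕ | S ⊆ Finset.Icc 1 (2 * N - 1) ∧ S.card = N - 1 ∧ N ∉ S ∧
        ∀ a ∈ S, ∀ b ∈ S, a ≠ b + N} := by
  refine ⟨fun lam hlam => ?_, fun lam hlam mu hmu h => ?_, fun S hS => ?_⟩
  · obtain ⟨hsum, hne⟩ := (admissible_iff hN lam).1 hlam
    have h0 := partialSum_zero N lam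
    refine ⟨fun a ha => ?_, card_image_partialSum lam, fun hmem => ?_, fun a ha b hb hab => ?_⟩
    · obtain ⟨i, hi, rfl⟩ := Finset.mem_image.1 ha
      rw [Finset.mem_Icc] at hi ⊢
      have h₁ := partialSum_lt lam (i := 0) (j := i) (by omega) (by omega)
      rcases hi.2.lt_or_eq with h | h
      · have := partialSum_lt lam h (by omega)
        omega
      · rw [h] at h₁ ⊢
        omega
    · obtain ⟨i, hi, hiN⟩ := Finset.mem_image.1 hmem
      rw [Finset.mem_Icc] at hi
      have := hne 0 i (by omega) (by omega)
      omega
    · obtain ⟨i, hi, rfl⟩ := Finset.mem_image.1 ha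
      obtain ⟨j, hj, rfl⟩ := Finset.mem_image.1 hb
      rw [Finset.mem_Icc] at hi hj
      rcases lt_trichotomy i j with h | rfl | h
      · have := partialSum_lt lam h (by omega)
        omega
      · omega
      · exact hne j i h (by omega) hab
  · refine eq_of_partialSum_eq hN hlam hmu fun i hi => ?_
    cases i with
    | zero => rw [partialSum_zero, partialSum_zero]
    | succ i =>
      have h₁ := partialSum_eq_orderEmbOfFin lam (card_image_partialSum lam)
        (fun i hi => Finset.mem_image_of_mem _ hi) ⟨i, by omega⟩
      have h₂ := partialSum_eq_orderEmbOfFin mu (card_image_partialSum lam)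
        (fun i hi => (congrArg (partialSum N mu i ∈ ·) h).mpr (Finset.mem_image_of_mem _ hi))
        ⟨i, by omega⟩
      exact h₁.trans h₂.symm
  · obtain ⟨hsub, hcard, hNS, hdiff⟩ := hS
    let F : ℕ → ℕ := fun i =>
      if h : 1 ≤ i ∧ i < N then S.orderEmbOfFin hcard ⟨i - 1, by omega⟩ else 0
    have hFmem : ∀ i, 1 ≤ i → i < N → F i ∈ S := fun i h₁ h₂ => by
      simp only [F, h₁, h₂, and_self, dite_true, Finset.orderEmbOfFin_mem]
    have hF0 : F 0 = 0 := by simp [F]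
    have hFlt : ∀ i, i + 1 < N → F i < F (i + 1) := fun i hi => by
      rcases Nat.eq_zero_or_pos i with rfl | hpos
      · have := Finset.mem_Icc.1 (hsub (hFmem 1 le_rfl hi))
        rw [hF0]
        exact this.1
      · have h₁ : 1 ≤ i ∧ i < N := by omega
        have h₂ : 1 ≤ i + 1 ∧ i + 1 < N := by omega
        simp only [F, h₁, h₂, and_self, dite_true]
        rw [OrderEmbedding.lt_iff_lt, Fin.lt_def]
        simp only
        omega
    obtain ⟨lam, hlam0, hlam⟩ := exists_partialSum_eq hN F (2 * N - 1 - F (N - 1)) hF0 hFlt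
    have hlast : F (N - 1) ≤ 2 * N - 1 := by
      rcases Nat.eq_zero_or_pos (N - 1) with h | h
      · rw [h, hF0]
        omega
      · exact (Finset.mem_Icc.1 (hsub (hFmem (N - 1) h (by omega)))).2
    refine ⟨lam, (admissible_iff hN lam).2 ⟨?_, fun i j hij hj => ?_⟩, ?_⟩
    · rw [hlam0, hlam _ (by omega)]
      omega
    · rw [hlam i (by omega), hlam j hj]
      have hjS := hFmem j (by omega) hj
      rcases Nat.eq_zero_or_pos i with rfl | hpos
      · rw [hF0, zero_add]
        exact fun h => hNS (h ▸ hjS)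
      · exact hdiff _ hjS _ (hFmem i hpos (by omega))
    · refine Finset.eq_of_subset_of_card_le (fun a ha => ?_) ?_
      · obtain ⟨i, hi, rfl⟩ := Finset.mem_image.1 ha
        rw [Finset.mem_Icc] at hi
        rw [hlam i (by omega)]
        exact hFmem i hi.1 (by omega)
      · rw [hcard, card_image_partialSum]
end

section
/- For every integer N ≥ 1, the number of admissible N-tuples equals 2^{N−1}. (This is the count of su(N)_N modules appearing in the branching of the vacuum and vector modules of so(N²−1)_1, i.e., the number of vacua of the Neveu–Schwarz sector of massless SU(N) adjoint QCD predicted by the Spin(N²−1)_1/SU(N)_N coset.) -/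
open Finset in
/-- The sum of `lam i + 1` over the indices `i < n`. -/
def shiftedSum {N : ℕ} (lam : Fin N → ℕ) (n : ℕ) : ℕ :=
  ∑ i with i.val < n, (lam i + 1)

section shiftedSum

open Finset

variable {N : ℕ} {lam : Fin N → ℕ}

theorem shiftedSum_zero : shiftedSum lam 0 = 0 := by
  simp [shiftedSum]

theorem shiftedSum_self : shiftedSum lam N = ∑ i, (lam i + 1) := by
  simp [shiftedSum]

theorem shiftedSum_add_sum_Icc {i j : Fin N} (hij : i ≤ j) :
    shiftedSum lam i + ∑ k ∈ Icc i j, (lam k + 1) = shiftedSum lam (j + 1) := by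
  unfold shiftedSum
  rw [← sum_union]
  · congr 1
    ext k
    simp only [mem_union, mem_filter, mem_univ, true_and, mem_Icc, Fin.le_def] at hij ⊢
    omega
  · rw [disjoint_left]
    intro k hk hk'
    simp only [mem_filter, mem_univ, true_and, mem_Icc, Fin.le_def] at hk hk'
    omega

theorem shiftedSum_succ (i : Fin N) :
    shiftedSum lam (i + 1) = shiftedSum lam i + (lam i + 1) := by
  rw [← shiftedSum_add_sum_Icc le_rfl, Icc_self, sum_singleton]

theorem shiftedSum_lt {m n : ℕ} (hmn : m < n) (hn : n ≤ N) :
    shiftedSum lam m < shiftedSum lam n := by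
  induction n, hmn using Nat.le_induction with
  | base =>
    have := shiftedSum_succ (lam := lam) ⟨m, hn⟩
    simp only [Nat.succ_eq_add_one] at this ⊢
    omega
  | succ n hmn ih =>
    have := shiftedSum_succ (lam := lam) ⟨n, hn⟩
    simp only at this
    have := ih (by omega)
    omega

theorem strictMono_shiftedSum_val : StrictMono fun i : Fin N => shiftedSum lam i :=
  fun _ j hij => shiftedSum_lt hij j.isLt.le

theorem admissible_iff_shiftedSum :
    Admissible N lam ↔ shiftedSum lam N = 2 * N ∧
      ∀ m n, m < n → n ≤ N → shiftedSum lam m + N ≠ shiftedSum lam n := by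
  rw [Admissible, shiftedSum_self]
  refine and_congr_right fun _ => ⟨fun h m n hmn hn he => ?_, fun h i j hij he => ?_⟩
  · obtain ⟨n, rfl⟩ : ∃ k, n = k + 1 := ⟨n - 1, by omega⟩
    have hij : (⟨m, by omega⟩ : Fin N) ≤ ⟨n, by omega⟩ := by
      simp only [Fin.mk_le_mk]; omega
    have := shiftedSum_add_sum_Icc (lam := lam) hij
    simp only at this
    exact h _ _ hij (by omega)
  · have := shiftedSum_add_sum_Icc (lam := lam) hij
    rw [he] at this
    exact h i (j + 1) (by rw [Fin.le_def] at hij; omega) (by omega) this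

/-- The set of partial sums `shiftedSum lam n` for `n < N`. -/
def shiftedSums {N : ℕ} (lam : Fin N → ℕ) : Finset ℕ :=
  univ.image fun i : Fin N => shiftedSum lam i

theorem card_shiftedSums : #(shiftedSums lam) = N := by
  rw [shiftedSums, card_image_of_injective _ strictMono_shiftedSum_val.injective, card_univ,
    Fintype.card_fin]

theorem eq_of_shiftedSums_eq {lam' : Fin N → ℕ} (hN : shiftedSum lam N = shiftedSum lam' N)
    (h : shiftedSums lam = shiftedSums lam') : lam = lam' := by
  have h₁ := orderEmbOfFin_unique (card_shiftedSums (lam := lam))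
    (fun i => mem_image_of_mem _ (mem_univ i)) strictMono_shiftedSum_val
  have h₂ := orderEmbOfFin_unique (f := fun i : Fin N => shiftedSum lam' i)
    (card_shiftedSums (lam := lam))
    (fun i => h ▸ mem_image_of_mem _ (mem_univ i)) strictMono_shiftedSum_val
  have h₃ : ∀ n ≤ N, shiftedSum lam n = shiftedSum lam' n := by
    intro n hn
    rcases hn.eq_or_lt with rfl | hn
    · exact hN
    · exact congrFun (h₁.trans h₂.symm) ⟨n, hn⟩
  ext i
  have := shiftedSum_succ (lam := lam) i
  have := shiftedSum_succ (lam := lam') i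
  have := h₃ i i.isLt.le
  have := h₃ (i + 1) i.isLt
  omega

/-- A function strictly increasing on `[0, N]` and vanishing at `0` consists of partial sums. -/
theorem exists_shiftedSum_eq {Q : ℕ → ℕ} (h0 : Q 0 = 0) (hQ : ∀ n < N, Q n < Q (n + 1)) :
    ∃ lam : Fin N → ℕ, ∀ n ≤ N, shiftedSum lam n = Q n := by
  refine ⟨fun i => Q (i + 1) - Q i - 1, fun n => ?_⟩
  induction n with
  | zero => exact fun _ => shiftedSum_zero.trans h0.symm
  | succ n ih =>
    intro hn
    have := ih (by omega)
    have := hQ n hn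
    have := shiftedSum_succ (lam := fun i : Fin N => Q (i + 1) - Q i - 1) ⟨n, hn⟩
    simp only at this
    omega

end shiftedSum

section halfSystem

open Finset

/-- The subset of `[0, 2N)` containing exactly one of `x`, `x + N` for each `x < N`,
namely `x` if `x = 0` or `x ∈ B`, and `x + N` otherwise. -/
def halfSystem (N : ℕ) (B : Finset ℕ) : Finset ℕ :=
  insert 0 B ∪ (range N \ insert 0 B).image (· + N)

variable {N : ℕ} {B : Finset ℕ}

theorem insert_zero_subset_range (hN : 1 ≤ N) (hB : B ⊆ Ioo 0 N) : insert 0 B ⊆ range N := by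
  refine insert_subset (mem_range.2 hN) fun x hx => ?_
  exact mem_range.2 (mem_Ioo.1 (hB hx)).2

theorem mem_halfSystem {x : ℕ} (hN : 1 ≤ N) (hB : B ⊆ Ioo 0 N) :
    x ∈ halfSystem N B ↔
      x < N ∧ (x = 0 ∨ x ∈ B) ∨ N ≤ x ∧ x < 2 * N ∧ x - N ≠ 0 ∧ x - N ∉ B := by
  have h := insert_zero_subset_range hN hB
  simp only [halfSystem, mem_union, mem_image, mem_sdiff, mem_range]
  constructor
  · rintro (hx | ⟨y, ⟨hy, hyB⟩, rfl⟩)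
    · exact Or.inl ⟨mem_range.1 (h hx), mem_insert.1 hx⟩
    · rw [mem_insert, not_or] at hyB
      refine Or.inr ⟨by omega, by omega, ?_⟩
      simpa using hyB
  · rintro (⟨_, hx⟩ | ⟨h₁, h₂, h₃, h₄⟩)
    · exact Or.inl (mem_insert.2 hx)
    · exact Or.inr ⟨x - N, ⟨by omega, by simp [h₃, h₄]⟩, by omega⟩

theorem card_halfSystem (hN : 1 ≤ N) (hB : B ⊆ Ioo 0 N) : #(halfSystem N B) = N := by
  have h := insert_zero_subset_range hN hB
  rw [halfSystem, card_union_of_disjoint, card_image_of_injective _ (add_left_injective N),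
    card_sdiff_of_subset h, card_range]
  · have := card_le_card h
    rw [card_range] at this
    omega
  · rw [disjoint_left]
    intro x hx hx'
    obtain ⟨y, -, rfl⟩ := mem_image.1 hx'
    have := mem_range.1 (h hx)
    omega

theorem filter_halfSystem (hN : 1 ≤ N) (hB : B ⊆ Ioo 0 N) :
    {x ∈ halfSystem N B | x ∈ Ioo 0 N} = B := by
  ext x
  have := @hB x
  simp only [mem_filter, mem_halfSystem hN hB, mem_Ioo] at this ⊢
  constructor
  · rintro ⟨⟨_, hx | hx⟩ | hx, _⟩
    · omega
    · exact hx
    · omega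
  · intro hx
    exact ⟨Or.inl ⟨(this hx).2, Or.inr hx⟩, this hx⟩

theorem shiftedSums_eq_halfSystem (hN : 1 ≤ N) {lam : Fin N → ℕ} (h : Admissible N lam) :
    shiftedSums lam = halfSystem N {x ∈ shiftedSums lam | x ∈ Ioo 0 N} := by
  rw [admissible_iff_shiftedSum] at h
  obtain ⟨htot, hne⟩ := h
  have hB : {x ∈ shiftedSums lam | x ∈ Ioo 0 N} ⊆ Ioo 0 N := fun x hx => (mem_filter.1 hx).2
  have key : ∀ i j : Fin N, shiftedSum lam i + N ≠ shiftedSum lam j := by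
    intro i j he
    refine hne i j ?_ j.isLt.le he
    exact strictMono_shiftedSum_val.lt_iff_lt.1 (by omega : shiftedSum lam i < shiftedSum lam j)
  refine eq_of_subset_of_card_le (fun x hx => ?_) (by rw [card_halfSystem hN hB, card_shiftedSums])
  have hx' := hx
  obtain ⟨i, -, rfl⟩ := mem_image.1 hx
  have hi := shiftedSum_lt (lam := lam) i.isLt le_rfl
  rw [mem_halfSystem hN hB]
  simp only [mem_filter, mem_Ioo] at hx' ⊢
  by_cases hlt : shiftedSum lam i < N
  · refine Or.inl ⟨hlt, ?_⟩
    by_cases h0 : shiftedSum lam i = 0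
    · exact Or.inl h0
    · exact Or.inr ⟨hx', by omega, hlt⟩
  · refine Or.inr ⟨by omega, by omega, fun h0 => ?_, fun hmem => ?_⟩
    · have := key ⟨0, hN⟩ i
      simp only [shiftedSum_zero] at this
      omega
    · obtain ⟨j, -, hj⟩ := mem_image.1 hmem.1
      have := key j i
      omega

theorem exists_admissible_shiftedSums_eq (hN : 1 ≤ N) (hB : B ⊆ Ioo 0 N) :
    ∃ lam : Fin N → ℕ, Admissible N lam ∧ shiftedSums lam = halfSystem N B := by
  set e := (halfSystem N B).orderEmbOfFin (card_halfSystem hN hB) with he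
  have hmem : ∀ i, e i ∈ halfSystem N B := fun i => orderEmbOfFin_mem _ _ i
  have hlt : ∀ i, e i < 2 * N := by
    intro i
    have := (mem_halfSystem hN hB).1 (hmem i)
    omega
  let Q : ℕ → ℕ := fun n => if h : n < N then e ⟨n, h⟩ else 2 * N
  have hQ : ∀ n (h : n < N), Q n = e ⟨n, h⟩ := fun n h => dif_pos h
  have hQN : Q N = 2 * N := dif_neg (lt_irrefl N)
  have hQ0 : Q 0 = 0 := by
    have h0 : 0 ∈ Set.range e := by
      rw [he, range_orderEmbOfFin, mem_coe, mem_halfSystem hN hB]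
      exact Or.inl ⟨hN, Or.inl rfl⟩
    obtain ⟨k, hk⟩ := h0
    rw [hQ 0 hN]
    have : e ⟨0, hN⟩ ≤ e k := e.monotone (Fin.mk_le_of_le_val (Nat.zero_le _))
    omega
  have hQlt : ∀ n < N, Q n < Q (n + 1) := by
    intro n hn
    rw [hQ n hn]
    by_cases h : n + 1 < N
    · rw [hQ _ h]
      exact e.strictMono (Fin.mk_lt_mk.2 n.lt_succ_self)
    · rw [show n + 1 = N by omega, hQN]
      exact hlt _
  obtain ⟨lam, hlam⟩ := exists_shiftedSum_eq hQ0 hQlt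
  refine ⟨lam, admissible_iff_shiftedSum.2 ⟨(hlam N le_rfl).trans hQN, ?_⟩, ?_⟩
  · intro m n hmn hn heq
    rw [hlam m (by omega), hlam n hn, hQ m (by omega)] at heq
    have hm := (mem_halfSystem hN hB).1 (hmem ⟨m, by omega⟩)
    rcases hn.eq_or_lt with rfl | hn
    · rw [hQN] at heq
      rw [show e ⟨m, hmn⟩ = n by omega] at hm
      omega
    · rw [hQ n hn] at heq
      have hn' := (mem_halfSystem hN hB).1 (hmem ⟨n, hn⟩)
      have := hlt ⟨n, hn⟩
      rw [← heq, Nat.add_sub_cancel] at hn'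
      rcases hm with ⟨_, hm | hm⟩ | hm
      · omega
      · rcases hn' with hn' | hn'
        · omega
        · exact hn'.2.2.2 hm
      · omega
  · rw [← coe_inj, shiftedSums, coe_image, coe_univ, Set.image_univ,
      ← range_orderEmbOfFin _ (card_halfSystem hN hB), ← he]
    congr 1
    ext i
    rw [hlam i i.isLt.le, hQ i i.isLt]

end halfSystem

/-- For every integer `N ≥ 1`, the number of admissible `N`-tuples
equals `2^(N-1)`. -/
theorem card_admissible (N : ℕ) (hN : 1 ≤ N) :
    Nat.card {lam : Fin N → ℕ // Admissible N lam} = 2 ^ (N - 1) := by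
  let f : {lam : Fin N → ℕ // Admissible N lam} → (Finset.Ioo 0 N).powerset := fun lam =>
    ⟨{x ∈ shiftedSums lam.1 | x ∈ Finset.Ioo 0 N},
      Finset.mem_powerset.2 fun _ hx => (Finset.mem_filter.1 hx).2⟩
  have hf : Function.Bijective f := by
    refine ⟨fun ⟨lam, h⟩ ⟨lam', h'⟩ heq => Subtype.ext ?_, fun ⟨B, hB⟩ => ?_⟩
    · refine eq_of_shiftedSums_eq ?_ ?_
      · rw [(admissible_iff_shiftedSum.1 h).1, (admissible_iff_shiftedSum.1 h').1]
      · rw [shiftedSums_eq_halfSystem hN h, shiftedSums_eq_halfSystem hN h']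
        exact congrArg (halfSystem N) (congrArg Subtype.val heq)
    · have hB' := Finset.mem_powerset.1 hB
      obtain ⟨lam, h, hlam⟩ := exists_admissible_shiftedSums_eq hN hB'
      refine ⟨⟨lam, h⟩, Subtype.ext ?_⟩
      simp only [f, hlam]
      exact filter_halfSystem hN hB'
  rw [Nat.card_eq_of_bijective f hf, Nat.card_eq_fintype_card, Fintype.card_coe,
    Finset.card_powerset, Nat.card_Ioo, Nat.sub_zero]
end

section
/- Admissibility is invariant under cyclic shifts: if λ is an admissible N-tuple, then the cyclically shifted tuple σλ defined by (σλ)_k = λ_{(k+1) mod N} is also an admissible N-tuple. (This expresses the invariance of the branching rules under the ℤ_N outer automorphism, i.e., under the one-form symmetry action.) -/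
/-- The cyclic shift `k ↦ (k + 1) mod N` on `Fin N`. -/
def cyclicSucc (N : ℕ) (k : Fin N) : Fin N :=
  ⟨((k : ℕ) + 1) % N, Nat.mod_lt _ (Nat.zero_lt_of_lt k.isLt)⟩

theorem cyclicSucc_injective (N : ℕ) : Function.Injective (cyclicSucc N) := by
  intro a b hab
  have h : (a : ℕ) + 1 ≡ b + 1 [MOD N] := congrArg Fin.val hab
  exact Fin.ext ((Nat.ModEq.add_right_cancel' 1 h).eq_of_lt_of_lt a.isLt b.isLt)

theorem val_cyclicSucc_of_lt {N : ℕ} {k : Fin N} (hk : (k : ℕ) + 1 < N) :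
    (cyclicSucc N k : ℕ) = k + 1 :=
  Nat.mod_eq_of_lt hk

theorem sum_comp_cyclicSucc {M : Type*} [AddCommMonoid M] (N : ℕ) (f : Fin N → M) :
    ∑ k, f (cyclicSucc N k) = ∑ k, f k :=
  (Finite.injective_iff_bijective.mp (cyclicSucc_injective N)).sum_comp f

theorem sum_Icc_comp_cyclicSucc {M : Type*} [AddCommMonoid M] {N : ℕ} (f : Fin N → M)
    {i j : Fin N} (hij : i ≤ j) (hj : (j : ℕ) + 1 < N) :
    ∑ k ∈ Finset.Icc i j, f (cyclicSucc N k) =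
      ∑ k ∈ Finset.Icc (cyclicSucc N i) (cyclicSucc N j), f k := by
  have hi : (i : ℕ) + 1 < N := by have := Fin.le_def.mp hij; omega
  rw [← Finset.sum_image (g := cyclicSucc N) (cyclicSucc_injective N).injOn]
  congr 1
  ext m
  simp only [Finset.mem_image, Finset.mem_Icc, Fin.le_def, val_cyclicSucc_of_lt hi,
    val_cyclicSucc_of_lt hj]
  constructor
  · rintro ⟨k, ⟨hik, hkj⟩, rfl⟩
    rw [val_cyclicSucc_of_lt (by omega)]
    omega
  · rintro ⟨him, hmj⟩
    refine ⟨⟨m - 1, by omega⟩, by dsimp only; omega, Fin.ext ?_⟩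
    rw [val_cyclicSucc_of_lt (by dsimp only; omega)]
    dsimp only
    omega

/-- admissibility is invariant under the cyclic shift
`(σλ)_k = λ_{(k+1) mod N}`. -/
theorem admissible_cyclic_shift (N : ℕ) (hN : 1 ≤ N) (lam : Fin N → ℕ)
    (h : Admissible N lam) :
    Admissible N (fun k : Fin N =>
      lam ⟨((k : ℕ) + 1) % N, Nat.mod_lt _ (Nat.zero_lt_of_lt k.isLt)⟩) := by
  obtain ⟨hsum, hne⟩ := h
  change Admissible N (fun k => lam (cyclicSucc N k))
  have htotal : ∑ k, (lam (cyclicSucc N k) + 1) = 2 * N :=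
    (sum_comp_cyclicSucc N fun k => lam k + 1).trans hsum
  have hshift : ∀ i j : Fin N, i ≤ j → (j : ℕ) + 1 < N →
      ∑ k ∈ Finset.Icc i j, (lam (cyclicSucc N k) + 1) ≠ N := by
    intro i j hij hj
    rw [sum_Icc_comp_cyclicSucc (fun k => lam k + 1) hij hj]
    apply hne
    have := Fin.le_def.mp hij
    rw [Fin.le_def, val_cyclicSucc_of_lt hj, val_cyclicSucc_of_lt (by omega)]
    omega
  refine ⟨htotal, fun i j hij heq => ?_⟩
  by_cases hj : (j : ℕ) + 1 < N
  · exact hshift i j hij hj heq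
  -- The interval reaches the last index, so its complement is an initial interval.
  rw [← Finset.sum_add_sum_compl (Finset.Icc i j), heq] at htotal
  by_cases hi : (i : ℕ) = 0
  · have hempty : (Finset.Icc i j)ᶜ = ∅ := by
      ext m
      simp only [Finset.mem_compl, Finset.mem_Icc, Fin.le_def, Finset.notMem_empty, iff_false]
      omega
    rw [hempty, Finset.sum_empty] at htotal
    omega
  · have hcompl : (Finset.Icc i j)ᶜ =
        Finset.Icc (⟨0, hN⟩ : Fin N) ⟨i - 1, by omega⟩ := by
      ext m
      simp only [Finset.mem_compl, Finset.mem_Icc, Fin.le_def]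
      omega
    rw [hcompl] at htotal
    exact hshift ⟨0, hN⟩ ⟨i - 1, by omega⟩ (Fin.le_def.mpr (Nat.zero_le _))
      (by dsimp only; omega) (by omega)
end

section
/- Let N ≥ 1 and let d be a divisor of N such that N/d is even. Then there is no admissible N-tuple λ that is d-periodic, i.e., no admissible λ satisfies λ_{(k+d) mod N} = λ_k for all k. (Hence the number A_d^{(N)} of admissible N-tuples of minimal period d is nonzero only if N/d is an odd integer.) -/
/-- `λ` is `d`-periodic: `λ_{(k+d) mod N} = λ_k` for all `k`. -/
def IsPeriodic (N d : ℕ) (lam : Fin N → ℕ) : Prop :=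
  ∀ k : Fin N, lam ⟨((k : ℕ) + d) % N, Nat.mod_lt _ (Nat.zero_lt_of_lt k.isLt)⟩ = lam k

/-- The `N`-periodic extension to `ℕ` of a `d`-periodic `N`-tuple has period `d`. -/
theorem IsPeriodic.periodic_extension {N d : ℕ} {lam : Fin N → ℕ} (hN : 0 < N)
    (h : IsPeriodic N d lam) :
    Function.Periodic (fun k : ℕ => lam ⟨k % N, Nat.mod_lt k hN⟩ + 1) d := by
  intro k
  simpa only [Nat.mod_add_mod] using
    congrArg (· + 1) (h ⟨k % N, Nat.mod_lt k hN⟩)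

/-- if `d ∣ N` and `N/d` is even, there is no `d`-periodic admissible
`N`-tuple. -/
theorem no_periodic_admissible_of_even_quotient (N d : ℕ) (hN : 1 ≤ N) (hd : d ∣ N)
    (heven : Even (N / d)) :
    ¬ ∃ lam : Fin N → ℕ, Admissible N lam ∧ IsPeriodic N d lam := by
  rintro ⟨lam, ⟨hsum, hne⟩, hper⟩
  obtain ⟨e, he⟩ := heven
  have hNm : N = e * d + e * d := by
    rw [← Nat.add_mul, ← he, Nat.div_mul_cancel hd]
  have hm : 0 < e * d := by omega
  set f : ℕ → ℕ := fun k => lam ⟨k % N, Nat.mod_lt k hN⟩ + 1 with hf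
  have hf_val (k : Fin N) : lam k + 1 = f k := by
    simp [hf, Nat.mod_eq_of_lt k.isLt]
  have hf_shift : Function.Periodic f (e * d) := by
    exact_mod_cast (hper.periodic_extension hN).nat_mul e
  have hhalf : ∑ k ∈ Finset.range (e * d), f k = N := by
    have htotal : ∑ k ∈ Finset.range N, f k = 2 * N := by
      rw [← hsum, ← Fin.sum_univ_eq_sum_range]
      exact Finset.sum_congr rfl fun k _ => (hf_val k).symm
    have hdouble : ∑ k ∈ Finset.range N, f k = 2 * ∑ k ∈ Finset.range (e * d), f k := by
      rw [show Finset.range N = Finset.range (e * d + e * d) from congrArg _ hNm,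
        Finset.sum_range_add, two_mul]
      congr 1
      exact Finset.sum_congr rfl fun k _ => by rw [add_comm, hf_shift]
    omega
  refine hne ⟨0, hN⟩ ⟨e * d - 1, by omega⟩ (Nat.zero_le _) ?_
  have hmap := Fin.map_valEmbedding_Icc (⟨0, hN⟩ : Fin N) ⟨e * d - 1, by omega⟩
  have hrange : Finset.Icc 0 (e * d - 1) = Finset.range (e * d) := by
    ext k
    simp only [Finset.mem_Icc, Finset.mem_range]
    omega
  refine Eq.trans ?_ hhalf
  rw [← hrange, ← hmap, Finset.sum_map]
  exact Finset.sum_congr rfl fun k _ => hf_val k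
end

section
/- The fully antisymmetric representation minimizes the quadratic Casimir at fixed N-ality: for every integer N ≥ 2, every k with 1 ≤ k ≤ N−1, and every λ : {1,…,N−1} → ℕ with ∑_{i=1}^{N−1} i·λ_i ≡ k (mod N), one has C₂(λ) ≥ C₂(ω_k) = k(N−k)(N+1)/N. (Consequently, in the large-mass limit of SU(N) adjoint QCD the k-string tension is proportional to the quadratic Casimir k(N−k), minimized by the antisymmetric representation with k boxes.) -/
/-- The pairing of su(N) weights (in Dynkin labels, indexed by `Fin (N-1)` where the
index `i` stands for `i+1 ∈ {1,…,N-1}`):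
`⟨λ, μ⟩ = ∑_{i,j=1}^{N-1} (min(i,j) − ij/N) λ_i μ_j`. -/
def weightPairing (N : ℕ) (lam mu : Fin (N - 1) → ℚ) : ℚ :=
  ∑ i : Fin (N - 1), ∑ j : Fin (N - 1),
    ((min ((i : ℕ) + 1) ((j : ℕ) + 1) : ℚ) -
        (((i : ℕ) + 1) * ((j : ℕ) + 1) : ℚ) / (N : ℚ)) * lam i * mu j

/-- The quadratic Casimir `C₂(λ) = ⟨λ, λ + 2ρ⟩` of a dominant weight `λ`, where `ρ` is the
Weyl vector with all Dynkin labels equal to `1`. -/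
def casimir (N : ℕ) (lam : Fin (N - 1) → ℕ) : ℚ :=
  weightPairing N (fun i => (lam i : ℚ)) (fun i => (lam i : ℚ) + 2)

theorem sum_range_min (a M : ℕ) (h : a ≤ M) :
    ∑ j ∈ Finset.range M, min (a : ℚ) ((j : ℚ) + 1) = a * M - a * (a - 1) / 2 := by
  suffices H : ∀ M : ℕ, ∑ j ∈ Finset.range M, min (a : ℚ) ((j : ℚ) + 1) =
      if M ≤ a then (M : ℚ) * (M + 1) / 2 else a * M - a * (a - 1) / 2 by
    rw [H]
    split_ifs with h'
    · obtain rfl : a = M := le_antisymm h h'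
      ring
    · rfl
  intro M
  induction M with
  | zero => simp
  | succ M ih =>
    rw [Finset.sum_range_succ, ih]
    rcases lt_trichotomy M a with hlt | rfl | hgt
    · have : (M : ℚ) + 1 ≤ a := by exact_mod_cast hlt
      rw [if_pos hlt.le, if_pos (Nat.succ_le_of_lt hlt), min_eq_right this]
      push_cast
      ring
    · rw [if_pos le_rfl, if_neg (by omega), min_eq_left (by linarith)]
      push_cast
      ring
    · have : (a : ℚ) ≤ M := by exact_mod_cast hgt.le
      rw [if_neg (by omega), if_neg (by omega), min_eq_left (by linarith)]
      push_cast
      ring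

theorem sum_min_sub_mul_div (N : ℕ) (hN : 2 ≤ N) (i : Fin (N - 1)) :
    ∑ j : Fin (N - 1), ((min ((i : ℕ) + 1) ((j : ℕ) + 1) : ℚ) -
        (((i : ℕ) + 1) * ((j : ℕ) + 1) : ℚ) / (N : ℚ)) =
      ((i : ℕ) + 1 : ℚ) * (N - ((i : ℕ) + 1)) / 2 := by
  have hi := i.2
  generalize (i : ℕ) = a at hi ⊢
  obtain ⟨M, rfl⟩ : ∃ M, N = M + 1 := ⟨N - 1, by omega⟩
  have h := sum_range_min (a + 1) M (by omega)
  have h_id : ∀ m : ℕ, ∑ j ∈ Finset.range m, ((j : ℚ) + 1) = m * (m + 1) / 2 := by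
    intro m
    induction m with
    | zero => simp
    | succ m ih => rw [Finset.sum_range_succ, ih]; push_cast; ring
  rw [Finset.sum_sub_distrib, ← Finset.sum_div, ← Finset.mul_sum]
  rw [Nat.add_sub_cancel, Fin.sum_univ_eq_sum_range (fun j => min ((a : ℚ) + 1) ((j : ℚ) + 1)) M,
    Fin.sum_univ_eq_sum_range (fun j => (j : ℚ) + 1) M, h_id]
  push_cast at h ⊢
  rw [h]
  have : (M : ℚ) + 1 ≠ 0 := by positivity
  field_simp
  ring

theorem casimir_eq (N : ℕ) (hN : 2 ≤ N) (lam : Fin (N - 1) → ℕ) :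
    casimir N lam = weightPairing N (fun i => (lam i : ℚ)) (fun i => (lam i : ℚ)) +
      ∑ i : Fin (N - 1), (lam i : ℚ) * (((i : ℕ) + 1 : ℚ) * (N - ((i : ℕ) + 1))) := by
  unfold casimir weightPairing
  rw [← Finset.sum_add_distrib]
  refine Finset.sum_congr rfl fun i _ => ?_
  have h : (lam i : ℚ) * (((i : ℕ) + 1 : ℚ) * (N - ((i : ℕ) + 1))) =
      (((i : ℕ) + 1 : ℚ) * (N - ((i : ℕ) + 1)) / 2) * (lam i * 2) := by ring
  rw [h, ← sum_min_sub_mul_div N hN i, Finset.sum_mul, ← Finset.sum_add_distrib]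
  exact Finset.sum_congr rfl fun j _ => by ring

theorem casimir_fundamental (N : ℕ) (hN : 2 ≤ N) (k : ℕ) (hk1 : 1 ≤ k) (hk2 : k ≤ N - 1) :
    casimir N (fun i => if (i : ℕ) + 1 = k then 1 else 0)
      = (k : ℚ) * ((N : ℚ) - (k : ℚ)) * ((N : ℚ) + 1) / (N : ℚ) := by
  obtain ⟨a, rfl⟩ : ∃ a, k = a + 1 := ⟨k - 1, by omega⟩
  have h : ∀ i : Fin (N - 1), (i : ℕ) + 1 = a + 1 ↔ i = ⟨a, by omega⟩ := by
    intro i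
    rw [Fin.ext_iff]
    simp
  rw [casimir_eq N hN]
  unfold weightPairing
  simp only [h, Nat.cast_ite, Nat.cast_one, Nat.cast_zero, mul_ite, mul_one, mul_zero, ite_mul,
    one_mul, zero_mul, Finset.sum_ite_eq', Finset.mem_univ, if_true, min_self]
  have : (N : ℚ) ≠ 0 := by positivity
  push_cast
  field_simp
  ring

theorem mod_mul_sub_mod_subadditive (N : ℕ) (hN : 0 < N) (a b : ℕ) :
    (((a + b) % N : ℕ) : ℚ) * (N - ((a + b) % N : ℕ)) ≤
      ((a % N : ℕ) : ℚ) * (N - (a % N : ℕ)) + ((b % N : ℕ) : ℚ) * (N - (b % N : ℕ)) := by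
  have ha := Nat.mod_lt a hN
  have hb := Nat.mod_lt b hN
  rw [Nat.add_mod]
  generalize a % N = r at *
  generalize b % N = s at *
  have hr : (r : ℚ) < N := by exact_mod_cast ha
  have hs : (s : ℚ) < N := by exact_mod_cast hb
  rcases lt_or_ge (r + s) N with h | h
  · rw [Nat.mod_eq_of_lt h]
    push_cast
    nlinarith [mul_nonneg (Nat.cast_nonneg (α := ℚ) r) (Nat.cast_nonneg (α := ℚ) s)]
  · rw [Nat.mod_eq_sub_mod h, Nat.mod_eq_of_lt (by omega), Nat.cast_sub h]
    push_cast
    nlinarith [mul_pos (sub_pos.2 hr) (sub_pos.2 hs)]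

theorem mul_sub_le_sum_of_nality (N : ℕ) (hN : 2 ≤ N) (k : ℕ) (hk : k ≤ N - 1)
    (lam : Fin (N - 1) → ℕ)
    (hnality : (∑ i : Fin (N - 1), ((i : ℕ) + 1) * lam i) ≡ k [MOD N]) :
    (k : ℚ) * (N - k) ≤
      ∑ i : Fin (N - 1), (lam i : ℚ) * (((i : ℕ) + 1 : ℚ) * (N - ((i : ℕ) + 1))) := by
  let f : ℕ → ℚ := fun n => ((n % N : ℕ) : ℚ) * (N - (n % N : ℕ))
  have f_zero : f 0 = 0 := by simp [f]
  have f_add : ∀ a b, f (a + b) ≤ f a + f b := mod_mul_sub_mod_subadditive N (by omega)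
  have f_mul : ∀ a n : ℕ, f (a * n) ≤ n * f a := by
    intro a n
    induction n with
    | zero => simp [f_zero]
    | succ n ih =>
      rw [Nat.mul_succ]
      push_cast
      linarith [f_add (a * n) a]
  have hfk : f (∑ i : Fin (N - 1), ((i : ℕ) + 1) * lam i) = (k : ℚ) * (N - k) := by
    have : (∑ i : Fin (N - 1), ((i : ℕ) + 1) * lam i) % N = k :=
      Eq.trans hnality (Nat.mod_eq_of_lt (by omega))
    simp only [f, this]
  rw [← hfk]
  refine (Finset.le_sum_of_subadditive f f_zero.le f_add _ _).trans
    (Finset.sum_le_sum fun i _ => (f_mul _ _).trans_eq ?_)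
  have : ((i : ℕ) + 1) % N = (i : ℕ) + 1 := Nat.mod_eq_of_lt (by omega)
  simp only [f, this]
  push_cast
  rfl

theorem min_sub_mul_div_nonneg {x y n : ℚ} (hx : 0 ≤ x) (hy : 0 ≤ y) (hxn : x ≤ n) (hyn : y ≤ n)
    (hn : 0 < n) : 0 ≤ min x y - x * y / n := by
  rw [sub_nonneg, le_min_iff, div_le_iff₀ hn, div_le_iff₀ hn]
  constructor <;> nlinarith

theorem sum_div_le_weightPairing_self (N : ℕ) (hN : 2 ≤ N) (lam : Fin (N - 1) → ℕ) :
    (∑ i : Fin (N - 1), (lam i : ℚ) * (((i : ℕ) + 1 : ℚ) * (N - ((i : ℕ) + 1)))) / N ≤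
      weightPairing N (fun i => (lam i : ℚ)) (fun i => (lam i : ℚ)) := by
  have hN0 : (0 : ℚ) < N := by positivity
  have hle : ∀ i : Fin (N - 1), ((i : ℕ) + 1 : ℚ) ≤ N := fun i => by
    exact_mod_cast (by omega : (i : ℕ) + 1 ≤ N)
  have hG : ∀ i j : Fin (N - 1), 0 ≤ (min ((i : ℕ) + 1) ((j : ℕ) + 1) : ℚ) -
      (((i : ℕ) + 1) * ((j : ℕ) + 1) : ℚ) / (N : ℚ) := fun i j =>
    min_sub_mul_div_nonneg (by positivity) (by positivity) (hle i) (hle j) hN0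
  unfold weightPairing
  rw [Finset.sum_div]
  refine Finset.sum_le_sum fun i _ => ?_
  refine le_trans ?_ (Finset.single_le_sum (fun j _ => mul_nonneg (mul_nonneg (hG i j)
    (Nat.cast_nonneg _)) (Nat.cast_nonneg _)) (Finset.mem_univ i))
  have hsq : (lam i : ℚ) ≤ lam i * lam i := by exact_mod_cast Nat.le_mul_self _
  have h := mul_le_mul_of_nonneg_left hsq (hG i i)
  rw [← mul_assoc] at h
  refine le_trans (le_of_eq ?_) h
  rw [min_self]
  field_simp

/-- the fully antisymmetric representation `ω_k` (the `k`-th fundamental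
weight) minimizes the quadratic Casimir among dominant weights of `N`-ality `k`, and
`C₂(ω_k) = k(N−k)(N+1)/N`. -/
theorem casimir_min_antisymmetric (N : ℕ) (hN : 2 ≤ N) (k : ℕ) (hk1 : 1 ≤ k)
    (hk2 : k ≤ N - 1) (lam : Fin (N - 1) → ℕ)
    (hnality : (∑ i : Fin (N - 1), ((i : ℕ) + 1) * lam i) ≡ k [MOD N]) :
    casimir N (fun i => if (i : ℕ) + 1 = k then 1 else 0)
        = (k : ℚ) * ((N : ℚ) - (k : ℚ)) * ((N : ℚ) + 1) / (N : ℚ) ∧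
      casimir N (fun i => if (i : ℕ) + 1 = k then 1 else 0) ≤ casimir N lam := by
  have hω := casimir_fundamental N hN k hk1 hk2
  refine ⟨hω, ?_⟩
  have hN0 : (0 : ℚ) < N := by positivity
  have hsum := mul_sub_le_sum_of_nality N hN k hk2 lam hnality
  have hdiv := div_le_div_of_nonneg_right hsum hN0.le
  have hpair := sum_div_le_weightPairing_self N hN lam
  have hsplit : (k : ℚ) * (N - k) * (N + 1) / N = k * (N - k) / N + k * (N - k) := by
    field_simp
    ring
  rw [hω, casimir_eq N hN, hsplit]
  linarith
end
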